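/- Theorem 2: Let M = ((U,V,R),F) and M' = ((U',V',R'),F') be strongly recursive causal models with U ⊆ U', V ⊆ V', and W⃗ = U' − U. If M is conservatively equivalent to M', then for all variables X, Y ∈ V: if X is an ancestor of Y in M, then X is an ancestor of Y in M'. In other words, the DAG of M is a sub-DAG of the DAG of M' when restricted to the variables in V. -/

import Mathlib

set_option linter.unusedVariables false

attribute [local instance] Classical.propDecidable

/-- A causal model `M = ((U,V,R),F)` with exogenous variables `U`, endogenous
variables `V`, ranges `RU u` / `RV v`, and for each endogenous variable a
structural equation giving its value in terms of the values of all the other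
variables (the equation may not depend on the variable's own value). -/
structure CausalModel (U V : Type) (RU : U → Type) (RV : V → Type) where
  F : ∀ X : V, (∀ u, RU u) → (∀ v, RV v) → RV X
  selfIndep : ∀ (X : V) (ctx : ∀ u, RU u) (a a' : ∀ v, RV v),
    (∀ Y : V, Y ≠ X → a Y = a' Y) → F X ctx a = F X ctx a'

namespace CausalModel

variable {U V : Type} {RU : U → Type} {RV : V → Type}

/-- `Y` depends on the endogenous variable `X`: for some context and some setting
of the endogenous variables, varying the value of `X` changes the value of `F Y`.
(`X` is then an (endogenous) parent of `Y`.) -/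
def DependsOnE (M : CausalModel U V RU RV) (Y X : V) : Prop :=
  X ≠ Y ∧ ∃ (ctx : ∀ u, RU u) (a : ∀ v, RV v) (x x' : RV X),
    M.F Y ctx (Function.update a X x) ≠ M.F Y ctx (Function.update a X x')

/-- `Y` depends on the exogenous variable `X`. -/
def DependsOnX (M : CausalModel U V RU RV) (Y : V) (X : U) : Prop :=
  ∃ (ctx : ∀ u, RU u) (a : ∀ v, RV v) (x x' : RU X),
    M.F Y (Function.update ctx X x) a ≠ M.F Y (Function.update ctx X x') a

/-- `M` is strongly recursive: there is a (strict) partial order on the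
endogenous variables such that whenever `Y` depends on `X`, `X` strictly
precedes `Y`. -/
def StronglyRecursive (M : CausalModel U V RU RV) : Prop :=
  ∃ lt : V → V → Prop, IsStrictOrder V lt ∧ ∀ Y X : V, M.DependsOnE Y X → lt X Y

/-- `a` simultaneously satisfies all structural equations of `M` in context `ctx`. -/
def Solves (M : CausalModel U V RU RV) (ctx : ∀ u, RU u) (a : ∀ v, RV v) : Prop :=
  ∀ X : V, a X = M.F X ctx a

/-- `(M,ctx) ⊨ P`: `P` holds of the solution of the equations of `M` in context `ctx`. -/
def Sat (M : CausalModel U V RU RV) (ctx : ∀ u, RU u) (P : (∀ v, RV v) → Prop) : Prop :=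
  ∀ a, M.Solves ctx a → P a

/-- The intervened model `M_{S ← b}`: the equation of each variable in `S` is
replaced by the constant value given by `b`; other equations are unchanged. -/
noncomputable def intervene (M : CausalModel U V RU RV) (S : Set V) (b : ∀ v, RV v) :
    CausalModel U V RU RV where
  F X ctx a := if X ∈ S then b X else M.F X ctx a
  selfIndep := by
    intro X ctx a a' h
    by_cases hX : X ∈ S
    · simp [hX]
    · simpa [hX] using M.selfIndep X ctx a a' h

/-- `X` is a parent of `Y` (both endogenous). -/
def ParentE (M : CausalModel U V RU RV) (X Y : V) : Prop := M.DependsOnE Y X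

/-- `X` is an ancestor of `Y` (both endogenous): transitive closure of parenthood. -/
def AncestorE (M : CausalModel U V RU RV) : V → V → Prop :=
  Relation.TransGen fun X Y => M.DependsOnE Y X

/-- The exogenous variable `X` is an ancestor of the endogenous variable `Y`. -/
def AncestorX (M : CausalModel U V RU RV) (X : U) (Y : V) : Prop :=
  ∃ Z : V, M.DependsOnX Z X ∧ (Z = Y ∨ M.AncestorE Z Y)

/-- `(x,x') ⤳ (y,y')` with witness `(ctx, z)`:
`F_Y(x,z,ctx) = y` and `F_Y(x',z,ctx) = y'`. -/
def LeadsToWith (M : CausalModel U V RU RV) (X : V) (x x' : RV X) (Y : V) (y y' : RV Y)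
    (ctx : ∀ u, RU u) (z : ∀ v, RV v) : Prop :=
  M.F Y ctx (Function.update z X x) = y ∧ M.F Y ctx (Function.update z X x') = y'

/-- `x` rather than `x'` is a potential parent of `y` rather than `y'`
(single endogenous variables). -/
def PotParentEE (M : CausalModel U V RU RV) (X : V) (x x' : RV X) (Y : V) (y y' : RV Y) :
    Prop :=
  X ≠ Y ∧ x ≠ x' ∧ y ≠ y' ∧ ∃ ctx z, M.LeadsToWith X x x' Y y y' ctx z

/-- `x` rather than `x'` (values of an exogenous variable `X`) is a potential
parent of `y` rather than `y'`. -/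
def PotParentXE (M : CausalModel U V RU RV) (X : U) (x x' : RU X) (Y : V) (y y' : RV Y) :
    Prop :=
  x ≠ x' ∧ y ≠ y' ∧ ∃ (ctx : ∀ u, RU u) (z : ∀ v, RV v),
    M.F Y (Function.update ctx X x) z = y ∧ M.F Y (Function.update ctx X x') z = y'

/-- `(x,x') ⤳_p (y,y')` for some directed path `p` starting at the exogenous
variable `X`: a chain of single-variable potential-parenthood steps. -/
inductive PotAncX (M : CausalModel U V RU RV) (X : U) (x x' : RU X) :
    ∀ Y : V, RV Y → RV Y → Prop
  | base {Y : V} {y y' : RV Y} : M.PotParentXE X x x' Y y y' → PotAncX M X x x' Y y y'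
  | step {Z : V} {z z' : RV Z} {Y : V} {y y' : RV Y} :
      PotAncX M X x x' Z z z' → M.PotParentEE Z z z' Y y y' → PotAncX M X x x' Y y y'

/-- `(x,x') ⤳_p (y,y')` for some directed path `p` between endogenous variables. -/
inductive PotAncE (M : CausalModel U V RU RV) (X : V) (x x' : RV X) :
    ∀ Y : V, RV Y → RV Y → Prop
  | base {Y : V} {y y' : RV Y} : M.PotParentEE X x x' Y y y' → PotAncE M X x x' Y y y'
  | step {Z : V} {z z' : RV Z} {Y : V} {y y' : RV Y} :
      PotAncE M X x x' Z z z' → M.PotParentEE Z z z' Y y y' → PotAncE M X x x' Y y y'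

/-- Direct sufficiency, Def. 3 (with possibly mixed exogenous/endogenous source
`(Se,xe) ∪ (Sv,xv)` and target `(Te,ye) ∪ (Tv,yv)`; in the basic case
`Se = Te = ∅`).  For every context agreeing with the exogenous part of the
source and every setting `z` of the endogenous variables outside the source and
the target, the target values are guaranteed. -/
def DirectlySufficient (M : CausalModel U V RU RV)
    (Se : Set U) (xe : ∀ u, RU u) (Sv : Set V) (xv : ∀ v, RV v)
    (Te : Set U) (ye : ∀ u, RU u) (Tv : Set V) (yv : ∀ v, RV v) : Prop :=
  ∀ ctx : ∀ u, RU u, (∀ u ∈ Se, ctx u = xe u) →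
    (∀ u ∈ Te, ctx u = ye u) ∧
    ∀ z : ∀ v, RV v,
      (M.intervene (Sv ∪ (Sv ∪ Tv)ᶜ) (Sv.piecewise xv z)).Sat ctx
        fun a => ∀ v ∈ Tv, a v = yv v

/-- `(xv on Sv)` is weakly sufficient for `(yv on Tv)` w.r.t. `(M, ctx)`:
`(M,ctx) ⊨ [Sv ← xv] Tv = yv`. -/
def WeaklySufficient (M : CausalModel U V RU RV) (ctx : ∀ u, RU u)
    (Sv : Set V) (xv : ∀ v, RV v) (Tv : Set V) (yv : ∀ v, RV v) : Prop :=
  (M.intervene Sv xv).Sat ctx fun a => ∀ v ∈ Tv, a v = yv v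

/-- Sufficiency, Def. 8: the chaining (transitive closure) of direct sufficiency,
starting from a source that may contain exogenous values `(Se,xe)`. -/
inductive Sufficient (M : CausalModel U V RU RV)
    (Se : Set U) (xe : ∀ u, RU u) (Sv : Set V) (xv : ∀ v, RV v) :
    Set V → (∀ v, RV v) → Prop
  | base (Tv : Set V) (yv : ∀ v, RV v) :
      M.DirectlySufficient Se xe Sv xv ∅ xe Tv yv → Sufficient M Se xe Sv xv Tv yv
  | step (Tv : Set V) (yv : ∀ v, RV v) (Tv' : Set V) (yv' : ∀ v, RV v) :
      Sufficient M Se xe Sv xv Tv yv →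
      M.DirectlySufficient ∅ xe Tv yv ∅ xe Tv' yv' →
      Sufficient M Se xe Sv xv Tv' yv'

/-- `(x⃗,x⃗') ⤳ (y⃗,y⃗')` via the explicit witness `(Ze,ze) ∪ (Zv,zv)`:
the source and target are distinct sets of variables, the contrast values
differ on the respective domains, `(z⃗,x⃗)` is directly sufficient for `y⃗`,
`(z⃗,x⃗')` is directly sufficient for `y⃗'`, and the source is minimal. -/
def JointParentVia (M : CausalModel U V RU RV)
    (Se : Set U) (xe xe' : ∀ u, RU u) (Sv : Set V) (xv xv' : ∀ v, RV v)
    (Te : Set U) (ye ye' : ∀ u, RU u) (Tv : Set V) (yv yv' : ∀ v, RV v)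
    (Ze : Set U) (ze : ∀ u, RU u) (Zv : Set V) (zv : ∀ v, RV v) : Prop :=
  (¬(Se = Te ∧ Sv = Tv)) ∧
  (∀ u ∈ Se, xe u ≠ xe' u) ∧ (∀ v ∈ Sv, xv v ≠ xv' v) ∧
  (∀ u ∈ Te, ye u ≠ ye' u) ∧ (∀ v ∈ Tv, yv v ≠ yv' v) ∧
  Disjoint Ze Se ∧ Disjoint Zv Sv ∧
  M.DirectlySufficient (Ze ∪ Se) (Se.piecewise xe ze) (Zv ∪ Sv) (Sv.piecewise xv zv)
    Te ye Tv yv ∧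
  M.DirectlySufficient (Ze ∪ Se) (Se.piecewise xe' ze) (Zv ∪ Sv) (Sv.piecewise xv' zv)
    Te ye' Tv yv' ∧
  ∀ (Se' : Set U) (Sv' : Set V), Se' ⊆ Se → Sv' ⊆ Sv → ¬(Se' = Se ∧ Sv' = Sv) →
    ¬(M.DirectlySufficient (Ze ∪ Se') (Se'.piecewise xe ze) (Zv ∪ Sv')
        (Sv'.piecewise xv zv) Te ye Tv yv ∧
      M.DirectlySufficient (Ze ∪ Se') (Se'.piecewise xe' ze) (Zv ∪ Sv')
        (Sv'.piecewise xv' zv) Te ye' Tv yv')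

/-- Potential joint parenthood, Def. 4: `(x⃗,x⃗') ⤳ (y⃗,y⃗')` for some witness. -/
def PotJointParent (M : CausalModel U V RU RV)
    (Se : Set U) (xe xe' : ∀ u, RU u) (Sv : Set V) (xv xv' : ∀ v, RV v)
    (Te : Set U) (ye ye' : ∀ u, RU u) (Tv : Set V) (yv yv' : ∀ v, RV v) : Prop :=
  ∃ (Ze : Set U) (ze : ∀ u, RU u) (Zv : Set V) (zv : ∀ v, RV v),
    M.JointParentVia Se xe xe' Sv xv xv' Te ye ye' Tv yv yv' Ze ze Zv zv

/-- Actual joint parenthood w.r.t. `(M,u)`: potential joint parenthood by a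
witness whose exogenous part is contained in `u` and whose endogenous part
(as well as the source) takes its actual value in `(M,u)`. -/
def ActJointParent (M : CausalModel U V RU RV) (u : ∀ u, RU u)
    (Se : Set U) (xe xe' : ∀ u, RU u) (Sv : Set V) (xv xv' : ∀ v, RV v)
    (Te : Set U) (ye ye' : ∀ u, RU u) (Tv : Set V) (yv yv' : ∀ v, RV v) : Prop :=
  ∃ (Ze : Set U) (ze : ∀ u, RU u) (Zv : Set V) (zv : ∀ v, RV v),
    M.JointParentVia Se xe xe' Sv xv xv' Te ye ye' Tv yv yv' Ze ze Zv zv ∧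
    (∀ w ∈ Ze, ze w = u w) ∧ (∀ w ∈ Se, xe w = u w) ∧
    M.Sat u fun a => (∀ v ∈ Zv, a v = zv v) ∧ (∀ v ∈ Sv, a v = xv v)

/-- Potential joint ancestry, Def. 5: `(x⃗,x⃗') ⤳_n (y⃗,y⃗')` for some network `n`,
i.e. the transitive closure of potential joint parenthood. -/
inductive PotJointAnc (M : CausalModel U V RU RV)
    (Se : Set U) (xe xe' : ∀ u, RU u) (Sv : Set V) (xv xv' : ∀ v, RV v) :
    ∀ (Te : Set U) (ye ye' : ∀ u, RU u) (Tv : Set V) (yv yv' : ∀ v, RV v), Prop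
  | base {Te : Set U} {ye ye' : ∀ u, RU u} {Tv : Set V} {yv yv' : ∀ v, RV v} :
      M.PotJointParent Se xe xe' Sv xv xv' Te ye ye' Tv yv yv' →
      PotJointAnc M Se xe xe' Sv xv xv' Te ye ye' Tv yv yv'
  | step {Te : Set U} {ye ye' : ∀ u, RU u} {Tv : Set V} {yv yv' : ∀ v, RV v}
      {Te' : Set U} {ye2 ye2' : ∀ u, RU u} {Tv' : Set V} {yv2 yv2' : ∀ v, RV v} :
      PotJointAnc M Se xe xe' Sv xv xv' Te ye ye' Tv yv yv' →
      M.PotJointParent Te ye ye' Tv yv yv' Te' ye2 ye2' Tv' yv2 yv2' →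
      PotJointAnc M Se xe xe' Sv xv xv' Te' ye2 ye2' Tv' yv2 yv2'

/-- Actual joint ancestry w.r.t. `(M,u)`, Def. 7. -/
inductive ActJointAnc (M : CausalModel U V RU RV) (u : ∀ u, RU u)
    (Se : Set U) (xe xe' : ∀ u, RU u) (Sv : Set V) (xv xv' : ∀ v, RV v) :
    ∀ (Te : Set U) (ye ye' : ∀ u, RU u) (Tv : Set V) (yv yv' : ∀ v, RV v), Prop
  | base {Te : Set U} {ye ye' : ∀ u, RU u} {Tv : Set V} {yv yv' : ∀ v, RV v} :
      M.ActJointParent u Se xe xe' Sv xv xv' Te ye ye' Tv yv yv' →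
      ActJointAnc M u Se xe xe' Sv xv xv' Te ye ye' Tv yv yv'
  | step {Te : Set U} {ye ye' : ∀ u, RU u} {Tv : Set V} {yv yv' : ∀ v, RV v}
      {Te' : Set U} {ye2 ye2' : ∀ u, RU u} {Tv' : Set V} {yv2 yv2' : ∀ v, RV v} :
      ActJointAnc M u Se xe xe' Sv xv xv' Te ye ye' Tv yv yv' →
      M.ActJointParent u Te ye ye' Tv yv yv' Te' ye2 ye2' Tv' yv2 yv2' →
      ActJointAnc M u Se xe xe' Sv xv xv' Te' ye2 ye2' Tv' yv2 yv2'

/-- Combine a family of values on `A` with a family of values on `B` into a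
family of values on `A ⊕ B`. -/
def extFn {A B : Type} {RA : A → Type} {RB : B → Type}
    (f : ∀ a, RA a) (g : ∀ b, RB b) : ∀ x : A ⊕ B, Sum.elim RA RB x
  | Sum.inl a => f a
  | Sum.inr b => g b

end CausalModel

namespace CausalModel

section

variable {U V : Type} {RU : U → Type} {RV : V → Type}

/-- The equation of `Z` only sees the values of the parents of `Z`. -/
theorem F_congr_of_dependsOnE [Finite V] (M : CausalModel U V RU RV) (Z : V)
    (ctx : ∀ u, RU u) (b b' : ∀ v, RV v) (h : ∀ X, M.DependsOnE Z X → b X = b' X) :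
    M.F Z ctx b = M.F Z ctx b' := by
  have := Fintype.ofFinite V
  have key : ∀ s : Finset V, M.F Z ctx (s.piecewise b' b) = M.F Z ctx b := by
    intro s
    induction s using Finset.induction_on with
    | empty => simp
    | insert j s hj ih =>
      rw [Finset.piecewise_insert, ← ih]
      by_cases hjZ : j = Z
      · subst hjZ
        exact M.selfIndep _ _ _ _ fun Y hY => Function.update_of_ne hY _ _
      · by_cases hd : M.DependsOnE Z j
        · rw [← h j hd, ← Finset.piecewise_eq_of_notMem s b' b hj, Function.update_eq_self]
        · by_contra hne
          refine hd ⟨hjZ, ctx, s.piecewise b' b, b' j, s.piecewise b' b j, ?_⟩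
          rwa [Function.update_eq_self]
  simpa using (key Finset.univ).symm

theorem dependsOnE_of_intervene {M : CausalModel U V RU RV} {S : Set V} {b : ∀ v, RV v}
    {Y X : V} (h : (M.intervene S b).DependsOnE Y X) : M.DependsOnE Y X := by
  obtain ⟨hne, ctx, a, x, x', h⟩ := h
  refine ⟨hne, ctx, a, x, x', fun he => h ?_⟩
  simp only [intervene, he]

theorem StronglyRecursive.intervene {M : CausalModel U V RU RV} (hM : M.StronglyRecursive)
    (S : Set V) (b : ∀ v, RV v) : (M.intervene S b).StronglyRecursive := by
  obtain ⟨lt, hlt, h⟩ := hM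
  exact ⟨lt, hlt, fun Y X hd => h Y X (dependsOnE_of_intervene hd)⟩

theorem StronglyRecursive.wellFounded [Finite V] {M : CausalModel U V RU RV}
    (hM : M.StronglyRecursive) : WellFounded fun X Y => M.DependsOnE Y X := by
  obtain ⟨lt, hlt, h⟩ := hM
  exact Subrelation.wf (fun {X Y} hd => h Y X hd) (Finite.wellFounded_of_trans_of_irrefl lt)

theorem StronglyRecursive.exists_solves [Finite V] {M : CausalModel U V RU RV}
    (hM : M.StronglyRecursive) (ctx : ∀ u, RU u) (d : ∀ v, RV v) :
    ∃ a, M.Solves ctx a := by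
  let G : ∀ Z : V, (∀ Y, M.DependsOnE Z Y → RV Y) → RV Z := fun Z f =>
    M.F Z ctx fun Y => if hY : M.DependsOnE Z Y then f Y hY else d Y
  refine ⟨hM.wellFounded.fix G, fun Z => ?_⟩
  rw [WellFounded.fix_eq]
  exact M.F_congr_of_dependsOnE Z ctx _ _ fun X hX => by simp [hX]

/-- Fixing all variables other than `Y` is weakly sufficient for the value that the
equation of `Y` assigns. -/
theorem weaklySufficient_compl_singleton (M : CausalModel U V RU RV) (ctx : ∀ u, RU u)
    (Y : V) (b : ∀ v, RV v) :
    M.WeaklySufficient ctx {Y}ᶜ b {Y} (Function.update b Y (M.F Y ctx b)) := by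
  rintro a ha Z rfl
  have hY : a Z = M.F Z ctx a := by simpa [CausalModel.intervene] using ha Z
  rw [hY, Function.update_self]
  refine M.selfIndep _ _ _ _ fun X hX => ?_
  simpa [CausalModel.intervene, hX] using ha X

/-- Solutions under two interventions on the same set agree on `Y` if the intervened values
agree on `Y` and all its ancestors. -/
theorem StronglyRecursive.solves_intervene_congr [Finite V] {M : CausalModel U V RU RV}
    (hM : M.StronglyRecursive) {ctx : ∀ u, RU u} {S : Set V} {b b' a a' : ∀ v, RV v}
    (ha : (M.intervene S b).Solves ctx a) (ha' : (M.intervene S b').Solves ctx a') (Y : V)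
    (h : ∀ Z ∈ S, (Z = Y ∨ M.AncestorE Z Y) → b Z = b' Z) : a Y = a' Y := by
  induction Y using hM.wellFounded.induction with
  | _ Y ih =>
    rw [ha Y, ha' Y]
    by_cases hY : Y ∈ S
    · simpa [CausalModel.intervene, hY] using h Y hY (Or.inl rfl)
    · simp only [CausalModel.intervene, hY, if_false]
      refine M.F_congr_of_dependsOnE Y ctx _ _ fun X hX => ih X hX fun Z hZ hZX => h Z hZ ?_
      rcases hZX with rfl | hZX
      · exact Or.inr (Relation.TransGen.single hX)
      · exact Or.inr (Relation.TransGen.tail hZX hX)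

end

end CausalModel

open CausalModel in
/-- Theorem 2: Let `M = ((U,V,R),F)` and
`M' = ((U ⊕ W, V ⊕ V₂, R'), F')` be strongly recursive causal models (so the
exogenous resp. endogenous variables of `M` are contained in those of `M'`,
with `W = U' − U`).  If `M` is conservatively equivalent to `M'` (with witness
`wv`), then for all common endogenous variables `X, Y ∈ V`: if `X` is an
ancestor of `Y` in `M` then `X` is an ancestor of `Y` in `M'`.  In other
words, the DAG of `M` is a sub-DAG of the DAG of `M'` when restricted to the
variables in `V`. -/
theorem conservativelyEquivalent_preserves_ancestors
    {U W V V₂ : Type} [Finite U] [Finite W] [Finite V] [Finite V₂]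
    {RU : U → Type} {RW : W → Type} {RV : V → Type} {RV₂ : V₂ → Type}
    (hRU : ∀ u, Nonempty (RU u)) (hRW : ∀ w, Nonempty (RW w))
    (hRV : ∀ v, Nonempty (RV v)) (hRV₂ : ∀ v, Nonempty (RV₂ v))
    (M : CausalModel U V RU RV)
    (M' : CausalModel (U ⊕ W) (V ⊕ V₂) (Sum.elim RU RW) (Sum.elim RV RV₂))
    (hM : M.StronglyRecursive) (hM' : M'.StronglyRecursive)
    (wv : ∀ w, RW w) (d₂ : ∀ v, RV₂ v)
    (hcons : ∀ (Sv : Set V) (xv : ∀ v, RV v) (Tv : Set V) (yv : ∀ v, RV v)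
        (u : ∀ u, RU u),
        M.WeaklySufficient u Sv xv Tv yv ↔
        M'.WeaklySufficient (extFn u wv) (Sum.inl '' Sv) (extFn xv d₂)
          (Sum.inl '' Tv) (extFn yv d₂)) :
    ∀ X Y : V, M.AncestorE X Y → M'.AncestorE (Sum.inl X) (Sum.inl Y) := by
  have step : ∀ X Y : V, M.DependsOnE Y X → M'.AncestorE (Sum.inl X) (Sum.inl Y) := by
    rintro X Y ⟨hXY, u, a, x, x', hne⟩
    by_contra hanc
    have hsol (b : ∀ v, RV v) : ∃ c,
        (M'.intervene (Sum.inl '' {Y}ᶜ) (extFn b d₂)).Solves (extFn u wv) c ∧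
          c (Sum.inl Y) = M.F Y u b := by
      obtain ⟨c, hc⟩ := (hM'.intervene (Sum.inl '' {Y}ᶜ) (extFn b d₂)).exists_solves
        (extFn u wv) (extFn b d₂)
      have hY := (hcons _ _ _ _ _).1 (M.weaklySufficient_compl_singleton u Y b) c hc
        (Sum.inl Y) ⟨Y, rfl, rfl⟩
      exact ⟨c, hc, hY.trans (Function.update_self _ _ _)⟩
    obtain ⟨c, hc, hcY⟩ := hsol (Function.update a X x)
    obtain ⟨c', hc', hcY'⟩ := hsol (Function.update a X x')
    refine hne (hcY.symm.trans (Eq.trans ?_ hcY'))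
    refine hM'.solves_intervene_congr hc hc' (Sum.inl Y) ?_
    rintro _ ⟨Z, hZ, rfl⟩ hZY
    have hZX : Z ≠ X := by
      rintro rfl
      rcases hZY with hZY | hZY
      · exact hXY (Sum.inl_injective hZY)
      · exact hanc hZY
    change Function.update a X x Z = Function.update a X x' Z
    rw [Function.update_of_ne hZX, Function.update_of_ne hZX]
  intro X Y h
  induction h with
  | single h => exact step _ _ h
  | tail _ h ih => exact Relation.TransGen.trans ih (step _ _ h)
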